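/- Let N ≥ 1 and a ∈ ℝ. With ℬ_{M+1}(a) denoting, for each M ≥ 0, the (M+1)×(M+1) tridiagonal matrix with diagonal entries −n, superdiagonal entries (i+1)a, and subdiagonal entries (M−i+1)(a−1) (0-indexed), one has for every real x: det(x·I_{N+1} + ℬ_{N+1}(a)) = (x + Na − N) · det((x−a)·I_N + ℬ_N(a)), where ℬ_N(a) is the N×N matrix built with parameter M = N−1. -/

import Mathlib

/-- Askey's matrix `ℬ_{M+1}(a)` of size `n = M + 1`: diagonal entries `-i`,
superdiagonal entries `(i + 1) a`, subdiagonal entries `(M - i + 1)(a - 1) = (n - i)(a - 1)`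
(0-indexed). -/
def askeyB (n : ℕ) (a : ℝ) : Matrix (Fin n) (Fin n) ℝ :=
  Matrix.of fun i j =>
    if (j : ℕ) = (i : ℕ) + 1 then ((i : ℕ) + 1 : ℝ) * a
    else if (i : ℕ) = (j : ℕ) + 1 then ((n : ℝ) - (i : ℕ)) * (a - 1)
    else if i = j then -((i : ℕ) : ℝ)
    else 0

/-- The matrix of `x + ℬ_{N+1}(a)` after the change of basis `t ^ j ↦ (1 - t) t ^ j` (`j < N`),
`t ^ N ↦ t ^ N`: block upper triangular with diagonal blocks `(x - a) + ℬ_N(a)` and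
`x + N a - N`. -/
def askeyBlock (N : ℕ) (a x : ℝ) : Matrix (Fin (N + 1)) (Fin (N + 1)) ℝ :=
  Matrix.of fun i j =>
    if (j : ℕ) = (i : ℕ) + 1 then ((i : ℕ) + 1 : ℝ) * a
    else if (i : ℕ) = (j : ℕ) + 1 then ((N : ℝ) - (i : ℕ)) * (a - 1)
    else if i = j then (if (i : ℕ) = N then x + N * a - N else x - a - (i : ℕ))
    else 0

/-- The lower bidiagonal matrix with `1` on the diagonal and `-1` just below it. -/
def lowerDifference (n : ℕ) : Matrix (Fin n) (Fin n) ℝ :=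
  Matrix.of fun i j => if i = j then 1 else if (i : ℕ) = (j : ℕ) + 1 then -1 else 0

theorem det_lowerDifference (n : ℕ) : (lowerDifference n).det = 1 := by
  rw [Matrix.det_of_isLowerTriangular]
  · simp [lowerDifference]
  · intro i j hij
    have hij : i < j := hij
    rw [Fin.lt_def] at hij
    simp only [lowerDifference, Matrix.of_apply, Fin.ext_iff]
    rw [if_neg (by omega), if_neg (by omega)]

theorem mul_lowerDifference_castSucc {n : ℕ} (A : Matrix (Fin (n + 1)) (Fin (n + 1)) ℝ)
    (i : Fin (n + 1)) (j : Fin n) :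
    (A * lowerDifference (n + 1)) i j.castSucc = A i j.castSucc - A i j.succ := by
  have h (k : Fin (n + 1)) : A i k * lowerDifference (n + 1) k j.castSucc =
      (if k = j.castSucc then A i k else 0) - (if k = j.succ then A i k else 0) := by
    simp only [lowerDifference, Matrix.of_apply, Fin.ext_iff, Fin.val_castSucc, Fin.val_succ]
    split_ifs <;> first | omega | simp
  simp [Matrix.mul_apply, h, Finset.sum_sub_distrib]

theorem mul_lowerDifference_last {n : ℕ} (A : Matrix (Fin (n + 1)) (Fin (n + 1)) ℝ)
    (i : Fin (n + 1)) :
    (A * lowerDifference (n + 1)) i (Fin.last n) = A i (Fin.last n) := by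
  have h (k : Fin (n + 1)) : A i k * lowerDifference (n + 1) k (Fin.last n) =
      if k = Fin.last n then A i k else 0 := by
    have := k.isLt
    simp only [lowerDifference, Matrix.of_apply, Fin.ext_iff, Fin.val_last]
    split_ifs <;> first | omega | simp
  simp [Matrix.mul_apply, h]

theorem det_askeyBlock (N : ℕ) (a x : ℝ) :
    (askeyBlock N a x).det = (x + (N : ℝ) * a - (N : ℝ)) *
      ((x - a) • (1 : Matrix (Fin N) (Fin N) ℝ) + askeyB N a).det := by
  have hrow (j : Fin N) : askeyBlock N a x (Fin.last N) j.castSucc = 0 := by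
    have := j.isLt
    simp only [askeyBlock, Matrix.of_apply, Fin.ext_iff, Fin.val_castSucc, Fin.val_last]
    split_ifs <;> first | omega | simp
  have hlast : askeyBlock N a x (Fin.last N) (Fin.last N) = x + N * a - N := by
    simp [askeyBlock]
  have hsub : (askeyBlock N a x).submatrix Fin.castSucc Fin.castSucc =
      (x - a) • (1 : Matrix (Fin N) (Fin N) ℝ) + askeyB N a := by
    ext i j
    have := i.isLt
    simp only [askeyBlock, askeyB, Matrix.submatrix_apply, Matrix.of_apply, Matrix.add_apply,
      Matrix.smul_apply, Matrix.one_apply, Fin.ext_iff, Fin.val_castSucc, smul_eq_mul]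
    split_ifs <;> first | omega | ring
  rw [Matrix.det_succ_row _ (Fin.last N), Fin.sum_univ_castSucc]
  simp [hrow, hlast, ← hsub, Fin.succAbove_last, ← two_mul]

theorem det_smul_one_add_askeyB (N : ℕ) (a x : ℝ) :
    (x • (1 : Matrix (Fin (N + 1)) (Fin (N + 1)) ℝ) + askeyB (N + 1) a).det =
      (askeyBlock N a x).det := by
  set A := x • (1 : Matrix (Fin (N + 1)) (Fin (N + 1)) ℝ) + askeyB (N + 1) a with hA
  have hdet : A.det = (A * lowerDifference (N + 1)).det := by
    rw [Matrix.det_mul, det_lowerDifference, mul_one]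
  rw [hdet]
  symm
  apply Matrix.det_eq_of_forall_row_eq_smul_add_pred (fun _ => (1 : ℝ))
  · intro j
    induction j using Fin.lastCases with
    | last =>
      rw [mul_lowerDifference_last]
      simp only [hA, askeyBlock, askeyB, Matrix.of_apply, Matrix.add_apply, Matrix.smul_apply,
        Matrix.one_apply, Fin.ext_iff, Fin.val_last, Fin.val_zero, smul_eq_mul, Nat.zero_ne_add_one,
        ↓reduceIte]
      split_ifs <;> first | omega | (subst_vars; push_cast; ring1) | grind
    | cast j =>
      have := j.isLt
      rw [mul_lowerDifference_castSucc]
      simp only [hA, askeyBlock, askeyB, Matrix.of_apply, Matrix.add_apply, Matrix.smul_apply,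
        Matrix.one_apply, Fin.ext_iff, Fin.val_castSucc, Fin.val_succ, Fin.val_zero, smul_eq_mul, Nat.zero_ne_add_one,
        ↓reduceIte]
      split_ifs <;> first | omega | (push_cast; ring1) | grind
  · intro i j
    have := i.isLt
    have hcast (h : N = i + 1) : (N : ℝ) = (i : ℕ) + 1 := by exact_mod_cast h
    induction j using Fin.lastCases with
    | last =>
      rw [mul_lowerDifference_last]
      simp only [hA, askeyBlock, askeyB, Matrix.of_apply, Matrix.add_apply, Matrix.smul_apply,
        Matrix.one_apply, Fin.ext_iff, Fin.val_last, Fin.val_succ, Fin.val_castSucc, smul_eq_mul]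
      split_ifs <;> first | omega | (push_cast; ring1) | (push_cast; rw [hcast (by omega)]; ring1)
    | cast j =>
      have := j.isLt
      rw [mul_lowerDifference_castSucc]
      simp only [hA, askeyBlock, askeyB, Matrix.of_apply, Matrix.add_apply, Matrix.smul_apply,
        Matrix.one_apply, Fin.ext_iff, Fin.val_castSucc, Fin.val_succ, smul_eq_mul]
      split_ifs <;> first | omega | (push_cast; ring1)

theorem askeyB_det_rec (N : ℕ) (hN : 1 ≤ N) (a : ℝ) (x : ℝ) :
    (x • (1 : Matrix (Fin (N + 1)) (Fin (N + 1)) ℝ) + askeyB (N + 1) a).det =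
      (x + (N : ℝ) * a - (N : ℝ)) *
        ((x - a) • (1 : Matrix (Fin N) (Fin N) ℝ) + askeyB N a).det := by
  rw [det_smul_one_add_askeyB, det_askeyBlock]
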